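/- arXiv:math/0703746 — 2 statements merged into one kernel-verified Lean document; each statement's English description precedes it below -/
import Mathlib

section
/- Let K ≥ 5 be a natural number and y : Fin K → ℝ with S > 0. Then the function (μ, λ) ↦ λ · f(μ, λ) is integrable over ℝ × (0, ∞), and the posterior mean of λ satisfies (∫_0^∞ ∫_ℝ λ f(μ, λ) dμ dλ) / (∫_0^∞ ∫_ℝ f(μ, λ) dμ dλ) = S/(K − 4), i.e. E(λ | y) = (K−1)s²/(K−4) where (K−1)s² = S. -/
open MeasureTheory Real Set

theorem integral_rpow_mul_exp_neg_div_Ioi {a b : ℝ} (ha : 0 < a) (hb : 0 < b) :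
    ∫ x in Ioi (0 : ℝ), x ^ (-a - 1) * exp (-(b / x)) = (1 / b) ^ a * Gamma a := by
  rw [← integral_rpow_mul_exp_neg_mul_Ioi ha hb,
    ← integral_comp_rpow_Ioi (fun t : ℝ => t ^ (a - 1) * exp (-(b * t))) (p := -1) (by norm_num)]
  refine setIntegral_congr_fun measurableSet_Ioi fun x (hx : 0 < x) => ?_
  simp only [abs_neg, abs_one, one_mul, smul_eq_mul]
  rw [← rpow_mul hx.le, ← mul_assoc, ← rpow_add hx, rpow_neg_one, div_eq_mul_inv]
  ring_nf

theorem integrableOn_rpow_mul_exp_neg_div_Ioi {a b : ℝ} (ha : 0 < a) (hb : 0 < b) :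
    IntegrableOn (fun x : ℝ => x ^ (-a - 1) * exp (-(b / x))) (Ioi 0) := by
  by_contra h
  have h0 := integral_rpow_mul_exp_neg_div_Ioi ha hb
  rw [integral_undef h] at h0
  have := Gamma_pos_of_pos ha
  have : 0 < (1 / b) ^ a * Gamma a := by positivity
  linarith

theorem sum_sub_sq_eq_sum_sub_mean_sq_add {K : ℕ} (hK : K ≠ 0) (y : Fin K → ℝ) (m : ℝ)
    (hm : m = (1 / (K : ℝ)) * ∑ j, y j) (μ : ℝ) :
    ∑ j, (y j - μ) ^ 2 = ∑ j, (y j - m) ^ 2 + K * (μ - m) ^ 2 := by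
  have hK' : (K : ℝ) ≠ 0 := Nat.cast_ne_zero.mpr hK
  have hsum : ∑ j, y j = K * m := by rw [hm]; field_simp
  simp only [sub_sq, Finset.sum_add_distrib, Finset.sum_sub_distrib, ← Finset.sum_mul,
    ← Finset.mul_sum, hsum, Finset.sum_const, Finset.card_univ, Fintype.card_fin, nsmul_eq_mul]
  ring

theorem integrable_exp_neg_mul_sub_sq {b : ℝ} (hb : 0 < b) (m : ℝ) :
    Integrable fun x : ℝ => exp (-b * (x - m) ^ 2) :=
  (integrable_exp_neg_mul_sq hb).comp_sub_right m

theorem integral_exp_neg_mul_sub_sq (b m : ℝ) :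
    ∫ x : ℝ, exp (-b * (x - m) ^ 2) = √(π / b) := by
  rw [integral_sub_right_eq_self (fun x : ℝ => exp (-b * x ^ 2)) m, integral_gaussian]

/-- For `K ≥ 5` and `S > 0`, the function `(μ, λ) ↦ λ · f(μ, λ)` is
integrable over `ℝ × (0, ∞)`, and the posterior mean of `λ` is `S/(K-4)`,
i.e. `E(λ | y) = (K-1)s²/(K-4)` where `(K-1)s² = S`. -/
theorem posterior_mean_lambda
    (K : ℕ) (hK : 5 ≤ K) (y : Fin K → ℝ)
    (ybar : ℝ) (hybar : ybar = (1 / (K : ℝ)) * ∑ j, y j)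
    (S : ℝ) (hS : S = ∑ j, (y j - ybar) ^ 2) (hSpos : 0 < S)
    (f : ℝ → ℝ → ℝ)
    (hf : ∀ (μ l : ℝ),
      f μ l = l ^ (-(((K : ℝ) + 1) / 2)) *
        Real.exp (-(1 / (2 * l)) * ∑ j, (y j - μ) ^ 2)) :
    IntegrableOn (fun p : ℝ × ℝ => p.2 * f p.1 p.2)
      ((Set.univ : Set ℝ) ×ˢ Set.Ioi (0 : ℝ)) ∧
    (∫ l in Set.Ioi (0 : ℝ), ∫ μ : ℝ, l * f μ l) /
      (∫ l in Set.Ioi (0 : ℝ), ∫ μ : ℝ, f μ l) = S / ((K : ℝ) - 4) := by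
  have hK0 : K ≠ 0 := by omega
  have hK5 : (5 : ℝ) ≤ K := by exact_mod_cast hK
  have hKpos : (0 : ℝ) < K := by linarith
  have hf' : ∀ μ l : ℝ, f μ l = l ^ (-(((K : ℝ) + 1) / 2)) * exp (-(S / 2 / l)) *
      exp (-(K / (2 * l)) * (μ - ybar) ^ 2) := by
    intro μ l
    rw [hf, sum_sub_sq_eq_sum_sub_mean_sq_add hK0 y ybar hybar μ, ← hS, mul_assoc, ← exp_add]
    congr 2
    ring
  have hint : ∀ l : ℝ, 0 < l → Integrable fun μ => f μ l := by
    intro l hl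
    simp only [hf']
    exact (integrable_exp_neg_mul_sub_sq (by positivity) ybar).const_mul _
  have hmarg : ∀ l : ℝ, 0 < l →
      ∫ μ, f μ l = √(2 * π / K) * (l ^ (-((K : ℝ) / 2 - 1) - 1) * exp (-(S / 2 / l))) := by
    intro l hl
    simp only [hf']
    rw [integral_const_mul, integral_exp_neg_mul_sub_sq,
      show π / (K / (2 * l)) = 2 * π / K * l by field_simp, sqrt_mul (by positivity),
      show -((K : ℝ) / 2 - 1) - 1 = -(((K : ℝ) + 1) / 2) + 1 / 2 by ring, rpow_add hl,
      ← sqrt_eq_rpow]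
    ring
  have hmarg' : ∀ l : ℝ, 0 < l →
      ∫ μ, l * f μ l = √(2 * π / K) * (l ^ (-((K : ℝ) / 2 - 2) - 1) * exp (-(S / 2 / l))) := by
    intro l hl
    rw [integral_const_mul, hmarg l hl,
      show -((K : ℝ) / 2 - 2) - 1 = -((K : ℝ) / 2 - 1) - 1 + 1 by ring, rpow_add_one hl.ne']
    ring
  have ha : (0 : ℝ) < K / 2 - 2 := by linarith
  have ha' : (0 : ℝ) < K / 2 - 1 := by linarith
  have hb : 0 < S / 2 := by positivity
  constructor
  · have hmeas : Measurable fun p : ℝ × ℝ => p.2 * f p.1 p.2 := by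
      simp only [hf']
      fun_prop
    rw [IntegrableOn, Measure.volume_eq_prod, ← Measure.prod_restrict, Measure.restrict_univ,
      integrable_prod_iff' hmeas.aestronglyMeasurable]
    constructor
    · filter_upwards [ae_restrict_mem measurableSet_Ioi] with l hl
      exact (hint l hl).const_mul l
    · refine ((integrableOn_rpow_mul_exp_neg_div_Ioi ha hb).const_mul √(2 * π / K)).congr ?_
      filter_upwards [ae_restrict_mem measurableSet_Ioi] with l (hl : 0 < l)
      rw [← hmarg' l hl]
      refine integral_congr_ae (.of_forall fun μ => ?_)
      have : 0 ≤ l * f μ l := by rw [hf']; positivity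
      exact (norm_of_nonneg this).symm
  · rw [setIntegral_congr_fun measurableSet_Ioi hmarg',
      setIntegral_congr_fun measurableSet_Ioi hmarg,
      integral_const_mul, integral_const_mul, integral_rpow_mul_exp_neg_div_Ioi ha hb,
      integral_rpow_mul_exp_neg_div_Ioi ha' hb,
      show (K : ℝ) / 2 - 1 = K / 2 - 2 + 1 by ring, Gamma_add_one ha.ne',
      rpow_add_one (by positivity)]
    have hG := (Gamma_pos_of_pos ha).ne'
    have hp : (1 / (S / 2)) ^ ((K : ℝ) / 2 - 2) ≠ 0 := by positivity
    have hs : √(2 * π / K) ≠ 0 := by positivity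
    have h4 : (K : ℝ) - 4 ≠ 0 := by linarith
    have ha0 := ha.ne'
    generalize (1 / (S / 2)) ^ ((K : ℝ) / 2 - 2) = P at *
    generalize Gamma ((K : ℝ) / 2 - 2) = G at *
    generalize √(2 * π / K) = C at *
    rw [div_eq_div_iff (by positivity) h4]
    field_simp
    ring
end

section
/- Let K ≥ 3 be a natural number, y : Fin K → ℝ with S > 0, and let q be a real number with 0 ≤ q < K − 2. Then the function (μ, λ) ↦ |μ|^q · f(μ, λ) is integrable over ℝ × (0, ∞); that is, the posterior distribution of μ has finite absolute moments of every order q < K − 2. -/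
open MeasureTheory Real Set

lemma integrableOn_rpow_neg_mul_exp_neg_div {r b : ℝ} (hr : 1 < r) (hb : 0 < b) :
    IntegrableOn (fun x : ℝ => x ^ (-r) * Real.exp (-(b / x))) (Ioi 0) := by
  have h := integrableOn_rpow_mul_exp_neg_mul_rpow (p := 1) (s := r - 2) (b := b)
    (by linarith) one_pos hb
  rw [← integrableOn_Ioi_comp_rpow_iff _ (show (-1 : ℝ) ≠ 0 by norm_num)] at h
  refine h.congr_fun (fun x hx => ?_) measurableSet_Ioi
  have hx : 0 < x := hx
  simp only [smul_eq_mul, abs_neg, abs_one, one_mul, Real.rpow_one]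
  rw [← mul_assoc, ← Real.rpow_mul hx.le, ← Real.rpow_add hx, Real.rpow_neg_one,
    neg_mul, ← div_eq_mul_inv]
  ring_nf

lemma exp_neg_le_rpow_mul_rpow_neg {s u : ℝ} (hs : 0 < s) (hu : 0 < u) :
    Real.exp (-u) ≤ s ^ s * u ^ (-s) := by
  have h1 : (u / s) ^ s ≤ Real.exp u := by
    calc (u / s) ^ s ≤ (Real.exp (u / s)) ^ s := by
          gcongr
          linarith [Real.add_one_le_exp (u / s)]
      _ = Real.exp u := by
          rw [← Real.exp_mul]
          congr 1
          field_simp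
  rw [Real.div_rpow hu.le hs.le, div_le_iff₀ (by positivity)] at h1
  rw [Real.exp_neg, Real.rpow_neg hu.le, ← div_eq_mul_inv, inv_eq_one_div,
    div_le_div_iff₀ (by positivity) (by positivity)]
  linarith

lemma sum_sub_sq_eq {K : ℕ} (hK : 0 < K) (y : Fin K → ℝ) (m : ℝ)
    (hm : m = (1 / (K : ℝ)) * ∑ j, y j) (t : ℝ) :
    ∑ j, (y j - t) ^ 2 = ∑ j, (y j - m) ^ 2 + K * (t - m) ^ 2 := by
  have hK' : (K : ℝ) ≠ 0 := by positivity
  have hsum : ∑ j, y j = K * m := by rw [hm]; field_simp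
  have h : ∀ j, (y j - t) ^ 2 = (y j - m) ^ 2 + (2 * (m - t) * y j + (t ^ 2 - m ^ 2)) :=
    fun j => by ring
  simp only [h, Finset.sum_add_distrib, ← Finset.mul_sum, hsum, Finset.sum_const,
    Finset.card_univ, Fintype.card_fin, nsmul_eq_mul]
  ring

lemma exists_mul_one_add_abs_sq_le {S k : ℝ} (hS : 0 < S) (hk : 1 ≤ k) (m : ℝ) :
    ∃ c > 0, ∀ t : ℝ, c * (1 + |t|) ^ 2 ≤ S + k * (t - m) ^ 2 := by
  refine ⟨(2 * (1 + |m|) ^ 2 / S + 2)⁻¹, by positivity, fun t => ?_⟩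
  rw [inv_mul_le_iff₀ (by positivity)]
  have h1 : |t| ≤ |m| + |t - m| := by
    simpa using abs_add_le m (t - m)
  have h2 : (1 + |t|) ^ 2 ≤ 2 * (1 + |m|) ^ 2 + 2 * (t - m) ^ 2 := by
    rw [← sq_abs (t - m)]
    have : (1 + |t|) ^ 2 ≤ (1 + |m| + |t - m|) ^ 2 := by gcongr ?_ ^ 2; linarith
    nlinarith [sq_nonneg (1 + |m| - |t - m|)]
  have h3 : 2 * (1 + |m|) ^ 2 / S * S = 2 * (1 + |m|) ^ 2 := by field_simp
  have h4 : 0 ≤ 2 * (1 + |m|) ^ 2 / S := by positivity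
  have h5 : (t - m) ^ 2 ≤ k * (t - m) ^ 2 := le_mul_of_one_le_left (sq_nonneg _) hk
  have h6 : 0 ≤ (2 * (1 + |m|) ^ 2 / S) * (k * (t - m) ^ 2) := by positivity
  nlinarith

lemma exp_neg_mul_sq_div_le {s c w l : ℝ} (hs : 0 < s) (hc : 0 < c) (hw : 1 ≤ w)
    (hl : 0 < l) :
    Real.exp (-(c * w ^ 2 / (2 * l))) ≤
      s ^ s * (c / 4) ^ (-s) * w ^ (-(2 * s)) * (l ^ s * Real.exp (-(c / 4 / l))) := by
  have hw0 : 0 < w := by linarith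
  have hu : 0 < c / 4 * w ^ 2 / l := by positivity
  have hpow : (c / 4 * w ^ 2 / l) ^ (-s) = (c / 4) ^ (-s) * w ^ (-(2 * s)) * l ^ s := by
    rw [Real.div_rpow (by positivity) hl.le, Real.mul_rpow (by positivity) (by positivity),
      ← Real.rpow_natCast_mul hw0.le, Real.rpow_neg hl.le s, div_inv_eq_mul]
    congr 3
    push_cast
    ring
  have hle : Real.exp (-(c / 4 * w ^ 2 / l)) ≤ Real.exp (-(c / 4 / l)) := by
    gcongr
    exact le_mul_of_one_le_right (by positivity) (one_le_pow₀ hw)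
  calc Real.exp (-(c * w ^ 2 / (2 * l)))
      = Real.exp (-(c / 4 * w ^ 2 / l)) * Real.exp (-(c / 4 * w ^ 2 / l)) := by
        rw [← Real.exp_add]
        congr 1
        field_simp
        ring
    _ ≤ (s ^ s * (c / 4 * w ^ 2 / l) ^ (-s)) * Real.exp (-(c / 4 / l)) := by
        gcongr
        exact exp_neg_le_rpow_mul_rpow_neg hs hu
    _ = _ := by rw [hpow]; ring

/-- For `K ≥ 3`, `S > 0` and `0 ≤ q < K - 2`, the function
`(μ, λ) ↦ |μ|^q · f(μ, λ)` is integrable over `ℝ × (0, ∞)`: the posterior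
distribution of `μ` has finite absolute moments of every order `q < K - 2`. -/
theorem posterior_abs_moment_mu_integrable
    (K : ℕ) (hK : 3 ≤ K) (y : Fin K → ℝ)
    (ybar : ℝ) (hybar : ybar = (1 / (K : ℝ)) * ∑ j, y j)
    (S : ℝ) (hS : S = ∑ j, (y j - ybar) ^ 2) (hSpos : 0 < S)
    (f : ℝ → ℝ → ℝ)
    (hf : ∀ (μ l : ℝ),
      f μ l = l ^ (-(((K : ℝ) + 1) / 2)) *
        Real.exp (-(1 / (2 * l)) * ∑ j, (y j - μ) ^ 2))
    (q : ℝ) (hq0 : 0 ≤ q) (hq : q < (K : ℝ) - 2) :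
    IntegrableOn (fun p : ℝ × ℝ => |p.1| ^ q * f p.1 p.2)
      ((Set.univ : Set ℝ) ×ˢ Set.Ioi (0 : ℝ)) := by
  have hK1 : (1 : ℝ) ≤ K := by exact_mod_cast (by omega : 1 ≤ K)
  obtain ⟨c, hc, hQ⟩ := exists_mul_one_add_abs_sq_le hSpos hK1 ybar
  set s : ℝ := (q + K) / 4 with hs_def
  have hs : 0 < s := by positivity
  have hμ : Integrable (fun t : ℝ => s ^ s * (c / 4) ^ (-s) * (1 + ‖t‖) ^ (-(2 * s - q))) := by
    refine (integrable_one_add_norm ?_).const_mul _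
    rw [Module.finrank_self, Nat.cast_one]
    linarith
  have hl : IntegrableOn (fun l : ℝ => l ^ (-((K + 1) / 2 - s)) * Real.exp (-(c / 4 / l)))
      (Ioi 0) :=
    integrableOn_rpow_neg_mul_exp_neg_div (by linarith) (by positivity)
  have hprod := hμ.mul_prod hl
  have hrestrict : (volume : Measure (ℝ × ℝ)).restrict (univ ×ˢ Ioi (0 : ℝ)) =
      (volume : Measure ℝ).prod (volume.restrict (Ioi (0 : ℝ))) := by
    rw [Measure.volume_eq_prod, ← Measure.prod_restrict, Measure.restrict_univ]
  rw [← hrestrict] at hprod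
  simp only [hf]
  refine hprod.mono' (Measurable.aestronglyMeasurable (by fun_prop)) ?_
  filter_upwards [ae_restrict_mem (MeasurableSet.univ.prod measurableSet_Ioi)]
  rintro ⟨t, l⟩ ⟨-, hl0 : 0 < l⟩
  dsimp only
  rw [Real.norm_of_nonneg (by positivity), sum_sub_sq_eq (by omega) y ybar hybar t, ← hS]
  have hw : 0 < 1 + |t| := by positivity
  calc |t| ^ q * (l ^ (-(((K : ℝ) + 1) / 2)) *
        Real.exp (-(1 / (2 * l)) * (S + K * (t - ybar) ^ 2)))
      ≤ (1 + |t|) ^ q * (l ^ (-(((K : ℝ) + 1) / 2)) *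
        Real.exp (-(c * (1 + |t|) ^ 2 / (2 * l)))) := by
        rw [neg_mul, one_div_mul_eq_div]
        gcongr
        · linarith
        · exact hQ t
    _ ≤ (1 + |t|) ^ q * (l ^ (-(((K : ℝ) + 1) / 2)) *
        (s ^ s * (c / 4) ^ (-s) * (1 + |t|) ^ (-(2 * s)) *
          (l ^ s * Real.exp (-(c / 4 / l))))) := by
        gcongr
        exact exp_neg_mul_sq_div_le hs hc (by linarith [abs_nonneg t]) hl0
    _ = s ^ s * (c / 4) ^ (-s) * (1 + ‖t‖) ^ (-(2 * s - q)) *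
        (l ^ (-((K + 1) / 2 - s)) * Real.exp (-(c / 4 / l))) := by
        rw [Real.norm_eq_abs, show -(2 * s - q) = q + -(2 * s) by ring, Real.rpow_add hw,
          show -(((K : ℝ) + 1) / 2 - s) = -((K + 1) / 2) + s by ring, Real.rpow_add hl0]
        ring
end
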